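/- Assume the noise random vector ε ∈ ℝ^n is symmetric, i.e., ε and −ε have the same distribution. Let λ ≥ 0, let the penalty be h(β) = √n·λ·‖β‖₁, and let T ⊂ {1,...,p}. If φ(T,1) > 0, then there exists a target vector β* ∈ ℝ^p with supp(β*) ⊂ T such that the Lasso estimator β̂ satisfies P( (99/100)·λ√|T|/φ(T,1) ≤ ‖X(β̂ − β*)‖ ) ≥ 0.49. -/

import Mathlib

open MeasureTheory
open scoped ENNReal

/-- Euclidean norm of a vector in `ℝ^k`. -/
noncomputable def l2norm {k : ℕ} (v : Fin k → ℝ) : ℝ := Real.sqrt (∑ i, (v i) ^ 2)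

/-- The compatibility constant
`φ(T, c₀) = inf { √|T|·‖Xu‖ / (√n·(‖u_T‖₁ - (1/c₀)‖u_{T^c}‖₁)) : ‖u_{T^c}‖₁ < c₀‖u_T‖₁ }`. -/
noncomputable def compat {n p : ℕ} (X : Matrix (Fin n) (Fin p) ℝ)
    (T : Finset (Fin p)) (c₀ : ℝ) : ℝ :=
  sInf {x : ℝ | ∃ u : Fin p → ℝ, (∑ j ∈ Tᶜ, |u j|) < c₀ * ∑ j ∈ T, |u j| ∧
    x = Real.sqrt T.card * l2norm (X.mulVec u) /
      (Real.sqrt n * ((∑ j ∈ T, |u j|) - (1 / c₀) * ∑ j ∈ Tᶜ, |u j|))}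

lemma l2norm_nonneg {k : ℕ} (v : Fin k → ℝ) : 0 ≤ l2norm v := Real.sqrt_nonneg _

lemma l2norm_sq {k : ℕ} (v : Fin k → ℝ) : l2norm v ^ 2 = v ⬝ᵥ v := by
  rw [l2norm, Real.sq_sqrt (Finset.sum_nonneg fun i _ => sq_nonneg _), dotProduct]
  exact Finset.sum_congr rfl fun i _ => sq _

lemma l2norm_smul {k : ℕ} (s : ℝ) (hs : 0 ≤ s) (v : Fin k → ℝ) :
    l2norm (s • v) = s * l2norm v := by
  refine (sq_eq_sq₀ (l2norm_nonneg _) (mul_nonneg hs (l2norm_nonneg _))).1 ?_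
  rw [mul_pow, l2norm_sq, l2norm_sq, smul_dotProduct, dotProduct_smul, smul_eq_mul, smul_eq_mul]
  ring

lemma neg_mul_l2norm_le_dotProduct {k : ℕ} (v w : Fin k → ℝ) :
    -(l2norm v * l2norm w) ≤ v ⬝ᵥ w := by
  refine (abs_le.1 (abs_le_of_sq_le_sq ?_ (mul_nonneg (l2norm_nonneg v) (l2norm_nonneg w)))).1
  rw [mul_pow, l2norm_sq, l2norm_sq]
  simpa only [dotProduct, sq] using Finset.sum_mul_sq_le_sq_mul_sq Finset.univ v w

lemma nonpos_of_forall_le_mul {a c : ℝ} (h : ∀ t : ℝ, 0 < t → t ≤ 1 → a ≤ t * c) : a ≤ 0 := by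
  by_contra! ha
  have h1 := h 1 one_pos le_rfl
  have hc : 0 < c := by linarith
  have h2 := h (a / (2 * c)) (by positivity) (by rw [div_le_one (by positivity)]; linarith)
  have h3 : a / (2 * c) * c = a / 2 := by field_simp
  linarith

/-- First-order optimality condition for the Lasso. -/
lemma lasso_dotProduct_le {n p : ℕ} (X : Matrix (Fin n) (Fin p) ℝ) (y : Fin n → ℝ)
    {κ : ℝ} (hκ : 0 ≤ κ) (bh : Fin p → ℝ)
    (hmin : ∀ b : Fin p → ℝ, l2norm (X.mulVec bh - y) ^ 2 + 2 * (κ * ∑ j, |bh j|) ≤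
      l2norm (X.mulVec b - y) ^ 2 + 2 * (κ * ∑ j, |b j|)) (b : Fin p → ℝ) :
    X.mulVec (b - bh) ⬝ᵥ (y - X.mulVec bh) ≤ κ * ∑ j, |b j| - κ * ∑ j, |bh j| := by
  set w := X.mulVec (b - bh) with hw
  rw [← sub_nonpos]
  refine nonpos_of_forall_le_mul (c := w ⬝ᵥ w) fun t ht ht1 => ?_
  have h := hmin (bh + t • (b - bh))
  have habs : ∑ j, |(bh + t • (b - bh)) j| ≤ (1 - t) * ∑ j, |bh j| + t * ∑ j, |b j| := by
    rw [Finset.mul_sum, Finset.mul_sum, ← Finset.sum_add_distrib]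
    refine Finset.sum_le_sum fun j _ => ?_
    calc |(bh + t • (b - bh)) j| = |(1 - t) * bh j + t * b j| := by
          congr 1; simp; ring
      _ ≤ |(1 - t) * bh j| + |t * b j| := abs_add_le _ _
      _ = _ := by rw [abs_mul, abs_mul, abs_of_nonneg (by linarith : 0 ≤ 1 - t), abs_of_pos ht]
  have habs' := mul_le_mul_of_nonneg_left habs hκ
  have hX : X.mulVec (bh + t • (b - bh)) - y = t • w - (y - X.mulVec bh) := by
    rw [Matrix.mulVec_add, Matrix.mulVec_smul, ← hw]; abel
  have hX' : X.mulVec bh - y = -(y - X.mulVec bh) := by abel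
  rw [hX, hX', l2norm_sq, l2norm_sq] at h
  generalize y - X.mulVec bh = z at h ⊢
  have hexp : (t • w - z) ⬝ᵥ (t • w - z) = t ^ 2 * (w ⬝ᵥ w) - 2 * t * (w ⬝ᵥ z) + z ⬝ᵥ z := by
    simp only [sub_dotProduct, dotProduct_sub, smul_dotProduct, dotProduct_smul, smul_eq_mul,
      dotProduct_comm z w]
    ring
  rw [hexp, neg_dotProduct_neg] at h
  have hww : 0 ≤ w ⬝ᵥ w := by rw [← l2norm_sq]; positivity
  have key : t * (w ⬝ᵥ z - (κ * ∑ j, |b j| - κ * ∑ j, |bh j|)) ≤ t * (t * (w ⬝ᵥ w)) := by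
    nlinarith [mul_nonneg (sq_nonneg t) hww]
  exact le_of_mul_le_mul_left key ht

lemma compat_mul_le {n p : ℕ} (X : Matrix (Fin n) (Fin p) ℝ) (T : Finset (Fin p))
    (hφ : 0 ≤ compat X T 1) (u : Fin p → ℝ) :
    compat X T 1 * (Real.sqrt n * (∑ j ∈ T, |u j| - ∑ j ∈ Tᶜ, |u j|)) ≤
      Real.sqrt T.card * l2norm (X.mulVec u) := by
  have hR : 0 ≤ Real.sqrt T.card * l2norm (X.mulVec u) :=
    mul_nonneg (Real.sqrt_nonneg _) (l2norm_nonneg _)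
  rcases le_or_gt (∑ j ∈ T, |u j|) (∑ j ∈ Tᶜ, |u j|) with h | h
  · refine le_trans (mul_nonpos_of_nonneg_of_nonpos hφ ?_) hR
    exact mul_nonpos_of_nonneg_of_nonpos (Real.sqrt_nonneg _) (by linarith)
  rcases (Real.sqrt_nonneg (n : ℝ)).eq_or_lt with hn | hn
  · rw [← hn]; simpa using hR
  rw [← le_div_iff₀ (mul_pos hn (by linarith))]
  refine csInf_le ⟨0, ?_⟩ ⟨u, by simpa using h, by simp⟩
  rintro _ ⟨u, hu, rfl⟩
  exact div_nonneg (mul_nonneg (Real.sqrt_nonneg _) (l2norm_nonneg _))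
    (mul_nonneg (Real.sqrt_nonneg _) (by linarith))

lemma exists_lt_of_compat_pos {n p : ℕ} (X : Matrix (Fin n) (Fin p) ℝ) (T : Finset (Fin p))
    (hφ : 0 < compat X T 1) {c : ℝ} (hc : compat X T 1 < c) :
    ∃ u : Fin p → ℝ, 0 < l2norm (X.mulVec u) ∧
      Real.sqrt T.card * l2norm (X.mulVec u) ≤
        c * (Real.sqrt n * (∑ j ∈ T, |u j| - ∑ j ∈ Tᶜ, |u j|)) := by
  have hne : {x : ℝ | ∃ u : Fin p → ℝ, (∑ j ∈ Tᶜ, |u j|) < 1 * ∑ j ∈ T, |u j| ∧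
      x = Real.sqrt T.card * l2norm (X.mulVec u) /
        (Real.sqrt n * ((∑ j ∈ T, |u j|) - (1 / 1) * ∑ j ∈ Tᶜ, |u j|))}.Nonempty := by
    by_contra h
    rw [Set.not_nonempty_iff_eq_empty] at h
    rw [compat, h, Real.sInf_empty] at hφ
    exact lt_irrefl _ hφ
  obtain ⟨x, ⟨u, hu, rfl⟩, hx⟩ := exists_lt_of_csInf_lt hne hc
  have hlow := compat_mul_le X T hφ.le u
  simp only [one_mul, div_one] at hu hx
  have hd : 0 < ∑ j ∈ T, |u j| - ∑ j ∈ Tᶜ, |u j| := by linarith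
  have hn : 0 < Real.sqrt (n : ℝ) := by
    refine Real.sqrt_pos.2 (Nat.cast_pos.2 (Nat.pos_of_ne_zero ?_))
    rintro rfl
    have h0 : compat X T 1 = 0 := by
      refine le_antisymm (csInf_le ⟨0, ?_⟩ ⟨u, by simpa using hu, by simp⟩) hφ.le
      rintro _ ⟨v, -, rfl⟩
      simp
    exact hφ.ne' h0
  have hpos := mul_pos hn hd
  refine ⟨u, ?_, ((div_lt_iff₀ hpos).1 hx).le⟩
  refine (l2norm_nonneg _).lt_of_ne fun h0 => ?_
  rw [← h0, mul_zero] at hlow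
  exact absurd (mul_pos hφ hpos) (not_lt.2 hlow)

/-- Deterministic inequality satisfied by the Lasso error when the target is `-v` on `T`. -/
lemma lasso_error_ineq {n p : ℕ} (X : Matrix (Fin n) (Fin p) ℝ) (T : Finset (Fin p))
    (hφ : 0 < compat X T 1) {lam : ℝ} (hlam : 0 ≤ lam) (v : Fin p → ℝ) (e : Fin n → ℝ)
    (he : 0 ≤ X.mulVec v ⬝ᵥ e) (bs bh : Fin p → ℝ) (hT : ∀ j ∈ T, bs j = -v j)
    (hTc : ∀ j ∉ T, bs j = 0)
    (hmin : ∀ b : Fin p → ℝ,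
      l2norm (X.mulVec bh - (X.mulVec bs + e)) ^ 2 + 2 * (Real.sqrt n * lam * ∑ j, |bh j|) ≤
        l2norm (X.mulVec b - (X.mulVec bs + e)) ^ 2 + 2 * (Real.sqrt n * lam * ∑ j, |b j|)) :
    l2norm (X.mulVec (bh - bs)) ^ 2 +
        lam * (Real.sqrt n * (∑ j ∈ T, |v j| - ∑ j ∈ Tᶜ, |v j|)) ≤
      l2norm (X.mulVec (bh - bs)) *
        (l2norm (X.mulVec v) + lam * Real.sqrt T.card / compat X T 1 + l2norm e) := by
  have hopt := lasso_dotProduct_le X (X.mulVec bs + e)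
    (mul_nonneg (Real.sqrt_nonneg (n : ℝ)) hlam) bh hmin (bs + v)
  set φ := compat X T 1
  have hcomp := compat_mul_le X T hφ.le (bh - bs)
  set d := X.mulVec (bh - bs) with hd
  have h1 : X.mulVec (bs + v - bh) = X.mulVec v - d := by
    rw [hd, ← Matrix.mulVec_sub]; congr 1; abel
  have h2 : X.mulVec bs + e - X.mulVec bh = e - d := by
    rw [hd, Matrix.mulVec_sub]; abel
  have hb : ∑ j, |(bs + v) j| = ∑ j ∈ Tᶜ, |v j| := by
    rw [← Finset.sum_add_sum_compl T]
    rw [Finset.sum_eq_zero (s := T) (fun j hj => by simp [hT j hj]), zero_add]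
    exact Finset.sum_congr rfl fun j hj => by simp [hTc j (Finset.mem_compl.1 hj)]
  have hbh : ∑ j ∈ T, |v j| - (∑ j ∈ T, |(bh - bs) j| - ∑ j ∈ Tᶜ, |(bh - bs) j|) ≤
      ∑ j, |bh j| := by
    have hT' : ∑ j ∈ T, |v j| ≤ ∑ j ∈ T, |bh j| + ∑ j ∈ T, |(bh - bs) j| := by
      rw [← Finset.sum_add_distrib]
      refine Finset.sum_le_sum fun j hj => ?_
      calc |v j| = |bh j - (bh - bs) j| := by rw [← abs_neg (v j), ← hT j hj]; simp
        _ ≤ _ := abs_sub _ _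
    have hTc' : ∑ j ∈ Tᶜ, |(bh - bs) j| = ∑ j ∈ Tᶜ, |bh j| :=
      Finset.sum_congr rfl fun j hj => by simp [hTc j (Finset.mem_compl.1 hj)]
    rw [← Finset.sum_add_sum_compl T fun j => |bh j|]
    linarith
  have hcomp' : lam * (Real.sqrt n * (∑ j ∈ T, |(bh - bs) j| - ∑ j ∈ Tᶜ, |(bh - bs) j|)) ≤
      lam * Real.sqrt T.card / φ * l2norm d := by
    rw [div_mul_eq_mul_div, le_div_iff₀ hφ]
    nlinarith [mul_le_mul_of_nonneg_left hcomp hlam]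
  have hbh' := mul_le_mul_of_nonneg_left hbh (mul_nonneg (Real.sqrt_nonneg (n : ℝ)) hlam)
  rw [h1, h2, hb] at hopt
  simp only [sub_dotProduct, dotProduct_sub, ← l2norm_sq] at hopt
  have h3 := neg_mul_l2norm_le_dotProduct (X.mulVec v) (-d)
  have h4 := neg_mul_l2norm_le_dotProduct d (-e)
  have hneg : ∀ {k : ℕ} (w : Fin k → ℝ), l2norm (-w) = l2norm w := fun w => by simp [l2norm]
  rw [dotProduct_neg, hneg] at h3 h4
  nlinarith

lemma exists_lt_prob_l2norm_le {n : ℕ} {Ω : Type*} [MeasurableSpace Ω] (P : Measure Ω)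
    [IsProbabilityMeasure P] (ε : Ω → Fin n → ℝ) {c : ℝ≥0∞} (hc : c < 1) :
    ∃ K : ℕ, c < P {ω | l2norm (ε ω) ≤ K} := by
  have hmono : Monotone fun K : ℕ => {ω | l2norm (ε ω) ≤ K} := fun a b hab ω hω =>
    le_trans (Set.mem_ofPred.1 hω) (Nat.cast_le.2 hab)
  have hU : ⋃ K : ℕ, {ω | l2norm (ε ω) ≤ K} = Set.univ :=
    Set.eq_univ_of_forall fun ω => Set.mem_iUnion.2 (exists_nat_ge (l2norm (ε ω)))
  have h := tendsto_measure_iUnion_atTop (μ := P) hmono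
  rw [hU, measure_univ] at h
  exact (h.eventually (lt_mem_nhds hc)).exists

lemma half_le_prob_dotProduct_nonneg {n : ℕ} {Ω : Type*} [MeasurableSpace Ω] (P : Measure Ω)
    [IsProbabilityMeasure P] (ε : Ω → Fin n → ℝ) (hmeas : Measurable ε)
    (hsym : Measure.map (fun ω => -(ε ω)) P = Measure.map ε P) (c : Fin n → ℝ) :
    1 / 2 ≤ P.real {ω | 0 ≤ c ⬝ᵥ ε ω} := by
  have hS : MeasurableSet {x : Fin n → ℝ | 0 ≤ c ⬝ᵥ x} :=
    measurableSet_le measurable_const (by unfold dotProduct; fun_prop)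
  have h := congrArg (fun μ : Measure (Fin n → ℝ) => μ {x | 0 ≤ c ⬝ᵥ x}) hsym
  simp only [Measure.map_apply hmeas hS,
    Measure.map_apply (f := fun ω => -(ε ω)) hmeas.neg hS] at h
  have h' : P.real {ω | 0 ≤ c ⬝ᵥ -(ε ω)} = P.real {ω | 0 ≤ c ⬝ᵥ ε ω} :=
    congrArg ENNReal.toReal h
  have hU : {ω | 0 ≤ c ⬝ᵥ -(ε ω)} ∪ {ω | 0 ≤ c ⬝ᵥ ε ω} = Set.univ := by
    refine Set.eq_univ_of_forall fun ω => ?_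
    simp only [dotProduct_neg, Set.mem_union, Set.mem_ofPred_eq, Left.nonneg_neg_iff]
    exact le_total _ _
  have h2 := measureReal_union_le (μ := P) {ω | 0 ≤ c ⬝ᵥ -(ε ω)} {ω | 0 ≤ c ⬝ᵥ ε ω}
  rw [hU, probReal_univ] at h2
  linarith

/-- for symmetric noise and any tuning parameter `λ ≥ 0`, if `φ(T,1) > 0`
there exists a target `β*` supported on `T` such that any Lasso solution `β̂` satisfies
`(99/100)·λ·√|T|/φ(T,1) ≤ ‖X(β̂-β*)‖` with probability at least `0.49`. -/
theorem lasso_compatibility_lower_bound {n p : ℕ} (X : Matrix (Fin n) (Fin p) ℝ)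
    {Ω : Type*} [MeasurableSpace Ω] (P : Measure Ω) [IsProbabilityMeasure P]
    (ε : Ω → Fin n → ℝ) (hmeas : Measurable ε)
    (hsym : Measure.map (fun ω => -(ε ω)) P = Measure.map ε P)
    (lam : ℝ) (hlam : 0 ≤ lam) (T : Finset (Fin p))
    (hφ : 0 < compat X T 1) :
    ∃ bs : Fin p → ℝ, (∀ j : Fin p, j ∉ T → bs j = 0) ∧
      ∀ bhat : Ω → Fin p → ℝ,
        (∀ ω : Ω, ∀ b : Fin p → ℝ,
          l2norm (X.mulVec (bhat ω) - (X.mulVec bs + ε ω)) ^ 2 +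
              2 * (Real.sqrt n * lam * ∑ j, |bhat ω j|) ≤
            l2norm (X.mulVec b - (X.mulVec bs + ε ω)) ^ 2 +
              2 * (Real.sqrt n * lam * ∑ j, |b j|)) →
        ENNReal.ofReal 0.49 ≤
          P {ω : Ω | (99 / 100) * lam * Real.sqrt T.card / compat X T 1 ≤
              l2norm (X.mulVec (bhat ω - bs))} := by
  set φ := compat X T 1 with hφdef
  set M := lam * Real.sqrt T.card / φ with hM
  have hM0 : 0 ≤ M := by positivity
  rcases hM0.eq_or_lt with hMz | hMpos
  · refine ⟨0, fun _ _ => rfl, fun bhat _ => ?_⟩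
    have huniv : {ω : Ω | (99 / 100) * lam * Real.sqrt T.card / φ ≤
        l2norm (X.mulVec (bhat ω - 0))} = Set.univ := by
      refine Set.eq_univ_of_forall fun ω => ?_
      have h0 : (99 / 100) * lam * Real.sqrt T.card / φ = 99 / 100 * M := by rw [hM]; ring
      simp only [Set.mem_ofPred_eq, h0, ← hMz, mul_zero]
      exact l2norm_nonneg _
    rw [huniv, measure_univ]
    exact ENNReal.ofReal_le_one.2 (by norm_num)
  obtain ⟨K, hK⟩ := exists_lt_prob_l2norm_le P ε (c := ENNReal.ofReal 0.99)
    (by rw [ENNReal.ofReal_lt_one]; norm_num)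
  obtain ⟨u, hu0, hu⟩ := exists_lt_of_compat_pos X T hφ (c := 1000 / 995 * φ) (by linarith)
  obtain ⟨s, hs⟩ := exists_nat_gt ((M + K) ^ 2 / (0.01 * M * l2norm (X.mulVec u)))
  have hs0 : (0 : ℝ) ≤ s := s.cast_nonneg
  rw [div_lt_iff₀ (by positivity)] at hs
  set v : Fin p → ℝ := (s : ℝ) • u with hv
  have hXv : l2norm (X.mulVec v) = s * l2norm (X.mulVec u) := by
    rw [hv, Matrix.mulVec_smul, l2norm_smul _ hs0]
  have hL : 0.995 * M * l2norm (X.mulVec v) ≤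
      lam * (Real.sqrt n * (∑ j ∈ T, |v j| - ∑ j ∈ Tᶜ, |v j|)) := by
    have hsum : ∀ A : Finset (Fin p), ∑ j ∈ A, |v j| = s * ∑ j ∈ A, |u j| := fun A => by
      rw [Finset.mul_sum]
      exact Finset.sum_congr rfl fun j _ => by
        rw [hv, Pi.smul_apply, smul_eq_mul, abs_mul, abs_of_nonneg hs0]
    rw [hsum, hsum, hXv]
    have h1 := mul_le_mul_of_nonneg_left hu (mul_nonneg hs0 hlam)
    have h2 : 0.995 * M * (s * l2norm (X.mulVec u)) =
        0.995 * (s * lam * (Real.sqrt T.card * l2norm (X.mulVec u))) / φ := by rw [hM]; ring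
    rw [h2, div_le_iff₀ hφ]
    linarith
  refine ⟨fun j => if j ∈ T then -v j else 0, fun j hj => if_neg hj, fun bhat hmin => ?_⟩
  set bs : Fin p → ℝ := fun j => if j ∈ T then -v j else 0
  have hsub : {ω | 0 ≤ X.mulVec v ⬝ᵥ ε ω} ∩ {ω | l2norm (ε ω) ≤ K} ⊆
      {ω : Ω | (99 / 100) * lam * Real.sqrt T.card / φ ≤ l2norm (X.mulVec (bhat ω - bs))} := by
    rintro ω ⟨h1, h2⟩
    simp only [Set.mem_ofPred_eq] at h1 h2 ⊢
    have h := lasso_error_ineq X T hφ hlam v (ε ω) h1 bs (bhat ω) (fun j hj => if_pos hj)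
      (fun j hj => if_neg hj) (hmin ω)
    have h0 : (99 / 100) * lam * Real.sqrt T.card / φ = 99 / 100 * M := by rw [hM]; ring
    rw [h0]
    by_contra! hlt
    have hr := l2norm_nonneg (X.mulVec (bhat ω - bs))
    rw [← hφdef, ← hM] at h
    set r := l2norm (X.mulVec (bhat ω - bs))
    set N := l2norm (X.mulVec v)
    have hN0 : 0 ≤ N := l2norm_nonneg _
    have hN : (M + K) ^ 2 < 0.01 * M * N := by rw [hXv]; linarith
    have hrε := mul_le_mul_of_nonneg_left h2 hr
    have hrN := mul_le_mul_of_nonneg_right hlt.le hN0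
    nlinarith [sq_nonneg (2 * r - (M + K)), sq_nonneg (M + K)]
  refine le_trans ?_ (measure_mono hsub)
  rw [← ofReal_measureReal (μ := P)]
  refine ENNReal.ofReal_le_ofReal ?_
  have hA := half_le_prob_dotProduct_nonneg P ε hmeas hsym (X.mulVec v)
  have hB : (0.99 : ℝ) ≤ P.real {ω | l2norm (ε ω) ≤ K} :=
    (ENNReal.ofReal_le_iff_le_toReal (measure_ne_top _ _)).1 hK.le
  have hBm : MeasurableSet {ω | l2norm (ε ω) ≤ K} :=
    measurableSet_le (by unfold l2norm; fun_prop) measurable_const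
  have hAB := measureReal_union_add_inter (μ := P) (s := {ω | 0 ≤ X.mulVec v ⬝ᵥ ε ω}) hBm
  have hle : P.real ({ω | 0 ≤ X.mulVec v ⬝ᵥ ε ω} ∪ {ω | l2norm (ε ω) ≤ K}) ≤ 1 :=
    measureReal_le_one
  linarith
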